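/- Suppose l(p) = 0, l'(p) ≠ 0 and η'(p) = 0, and set k = l''(p)/l'(p). Then γ''(p) ≠ 0, γ'''(p) = k·γ''(p), and det( γ''(p), 3·γ⁽⁵⁾(p) − 10·k·γ⁽⁴⁾(p) ) = 12·l'(p)·( l''(p)·η''(p) − l'(p)·η'''(p) ). In particular this determinant is nonzero if and only if l''(p)·η''(p) − l'(p)·η'''(p) ≠ 0. (By the cusp criterion, this says γ has a 5/2-cusp at p if and only if l''(p)·η''(p) − l'(p)·η'''(p) ≠ 0.) -/

import Mathlib

open Real

/-- Rotation of the plane by angle `θ`. -/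
noncomputable def rot (θ : ℝ) (v : ℝ × ℝ) : ℝ × ℝ :=
  (Real.cos θ * v.1 - Real.sin θ * v.2, Real.sin θ * v.1 + Real.cos θ * v.2)

/-- Determinant of the 2×2 matrix with columns `v`, `w`. -/
def det2 (v w : ℝ × ℝ) : ℝ := v.1 * w.2 - v.2 * w.1

theorem ContDiff.hasDerivAt_iteratedDeriv {f : ℝ → ℝ} (hf : ContDiff ℝ (⊤ : ℕ∞) f) (n : ℕ)
    (t : ℝ) : HasDerivAt (iteratedDeriv n f) (iteratedDeriv (n + 1) f t) t := by
  rw [iteratedDeriv_succ]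
  exact ((hf.differentiable_iteratedDeriv n (by exact_mod_cast WithTop.coe_lt_top n)) t).hasDerivAt

theorem contDiff_of_hasDerivAt {f f' : ℝ → ℝ} (hf' : ContDiff ℝ (⊤ : ℕ∞) f')
    (hf : ∀ t, HasDerivAt f (f' t) t) : ContDiff ℝ (⊤ : ℕ∞) f := by
  refine contDiff_infty_iff_deriv.2 ⟨fun t => (hf t).differentiableAt, ?_⟩
  rwa [show deriv f = f' from funext fun t => (hf t).deriv]

theorem hasDerivAt_of_eq_integral {f f' : ℝ → ℝ} (hf' : Continuous f')
    (hf : ∀ t, f t = ∫ u in (0:ℝ)..t, f' u) (t : ℝ) : HasDerivAt f (f' t) t := by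
  rw [show f = fun t => ∫ u in (0:ℝ)..t, f' u from funext hf]
  exact intervalIntegral.integral_hasDerivAt_right (hf'.intervalIntegrable _ _)
    (hf'.stronglyMeasurableAtFilter _ _) hf'.continuousAt

/-- The vector with coordinates `P`, `Q` in the frame `(S, C)`, `(C, -S)` of the plane. -/
def frameVec (S C P Q : ℝ) : ℝ × ℝ := (P * S + Q * C, P * C - Q * S)

/-- Differentiation in a frame that turns with angular velocity `w`. -/
theorem hasDerivAt_frameVec {S C w P Q : ℝ → ℝ} {P' Q' t : ℝ}
    (hS : HasDerivAt S (w t * C t) t) (hC : HasDerivAt C (-(w t * S t)) t)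
    (hP : HasDerivAt P P' t) (hQ : HasDerivAt Q Q' t) :
    HasDerivAt (fun t => frameVec (S t) (C t) (P t) (Q t))
      (frameVec (S t) (C t) (P' - w t * Q t) (Q' + w t * P t)) t := by
  have h := ((hP.mul hS).add (hQ.mul hC)).prodMk ((hP.mul hC).sub (hQ.mul hS))
  refine h.congr_deriv ?_
  simp only [frameVec, Prod.mk.injEq]
  constructor <;> ring

/-- The derivatives of a curve with velocity `l • (S, C)`, where the frame turns with angular
velocity `w`, at a zero of `l` and `w`. -/
theorem iteratedDeriv_of_deriv_eq_frameVec {γ : ℝ → ℝ × ℝ} {l S C w : ℝ → ℝ}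
    (hl : ContDiff ℝ (⊤ : ℕ∞) l) (hw : ContDiff ℝ (⊤ : ℕ∞) w)
    (hS : ∀ t, HasDerivAt S (w t * C t) t) (hC : ∀ t, HasDerivAt C (-(w t * S t)) t)
    (hγ : ∀ t, HasDerivAt γ (frameVec (S t) (C t) (l t) 0) t)
    {p : ℝ} (hlp : l p = 0) (hwp : w p = 0) :
    iteratedDeriv 2 γ p = frameVec (S p) (C p) (deriv l p) 0 ∧
    iteratedDeriv 3 γ p = frameVec (S p) (C p) (iteratedDeriv 2 l p) 0 ∧
    (∃ P, iteratedDeriv 4 γ p = frameVec (S p) (C p) P (3 * deriv l p * deriv w p)) ∧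
    ∃ P, iteratedDeriv 5 γ p = frameVec (S p) (C p) P
      (6 * iteratedDeriv 2 l p * deriv w p + 4 * deriv l p * iteratedDeriv 2 w p) := by
  have l0 (t) : HasDerivAt l (deriv l t) t := by
    simpa using hl.hasDerivAt_iteratedDeriv 0 t
  have l1 (t) : HasDerivAt (deriv l) (iteratedDeriv 2 l t) t := by
    simpa using hl.hasDerivAt_iteratedDeriv 1 t
  have l2 := hl.hasDerivAt_iteratedDeriv 2
  have l3 := hl.hasDerivAt_iteratedDeriv 3
  have w0 (t) : HasDerivAt w (deriv w t) t := by
    simpa using hw.hasDerivAt_iteratedDeriv 0 t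
  have w1 (t) : HasDerivAt (deriv w) (iteratedDeriv 2 w t) t := by
    simpa using hw.hasDerivAt_iteratedDeriv 1 t
  have w2 := hw.hasDerivAt_iteratedDeriv 2
  have step (n : ℕ) (P Q P' Q' : ℝ → ℝ)
      (hn : iteratedDeriv n γ = fun t => frameVec (S t) (C t) (P t) (Q t))
      (hP : ∀ t, HasDerivAt P (P' t) t) (hQ : ∀ t, HasDerivAt Q (Q' t) t) :
      iteratedDeriv (n + 1) γ = fun t =>
        frameVec (S t) (C t) (P' t - w t * Q t) (Q' t + w t * P t) := by
    rw [iteratedDeriv_succ, hn]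
    exact funext fun t => (hasDerivAt_frameVec (hS t) (hC t) (hP t) (hQ t)).deriv
  have g1 : iteratedDeriv 1 γ = fun t => frameVec (S t) (C t) (l t) 0 := by
    rw [iteratedDeriv_one]
    exact funext fun t => (hγ t).deriv
  have g2 := step 1 l (fun _ => 0) _ _ g1 l0 fun t => hasDerivAt_const t 0
  have g3 := step 2 _ _ _ _ g2 (fun t => (l1 t).sub ((w0 t).mul (hasDerivAt_const t 0)))
    fun t => (hasDerivAt_const t 0).add ((w0 t).mul (l0 t))
  simp only [mul_zero, sub_zero, zero_add, add_zero] at g2 g3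
  have g4 := step 3 _ _ _ _ g3
    (fun t => (l2 t).sub ((w0 t).mul ((w0 t).mul (l0 t))))
    fun t => (((w1 t).mul (l0 t)).add ((w0 t).mul (l1 t))).add ((w0 t).mul (l1 t))
  let P (t : ℝ) := iteratedDeriv 3 l t - 3 * w t * deriv w t * l t - 3 * w t ^ 2 * deriv l t
  let Q (t : ℝ) := iteratedDeriv 2 w t * l t + 3 * deriv w t * deriv l t
    + 3 * w t * iteratedDeriv 2 l t - w t ^ 3 * l t
  have h4 : iteratedDeriv 4 γ = fun t => frameVec (S t) (C t) (P t) (Q t) := by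
    rw [g4]
    funext t
    congr 1 <;> simp only [P, Q] <;> ring
  have hP : DifferentiableAt ℝ P p := by
    have := (l0 p).differentiableAt
    have := (l1 p).differentiableAt
    have := (l3 p).differentiableAt
    have := (w0 p).differentiableAt
    have := (w1 p).differentiableAt
    fun_prop
  have hQ := ((((w2 p).mul (l0 p)).add (((w1 p).const_mul 3).mul (l1 p))).add
    (((w0 p).const_mul 3).mul (l2 p))).sub (((w0 p).pow 3).mul (l0 p))
  have h5 := (hasDerivAt_frameVec (Q := Q) (hS p) (hC p) hP.hasDerivAt hQ).deriv
  rw [← h4, ← iteratedDeriv_succ] at h5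
  refine ⟨?_, ?_, ⟨P p, ?_⟩, ⟨deriv P p, ?_⟩⟩
  · simp [g2, hlp]
  · simp [g3, hlp, hwp]
  · rw [h4]
    simp only [Q, hlp, hwp]
    congr 1
    ring
  · rw [h5]
    simp only [Pi.pow_apply, hlp, hwp]
    congr 1 <;> ring

/-- Criterion for a 5/2-cusp of `γ` at a singular point `p` with `l'(p) ≠ 0`,
`η'(p) = 0` and `k = l''(p)/l'(p)`. -/
theorem cusp_52_criterion
    (l h : ℝ → ℝ) (hl : ContDiff ℝ (⊤ : ℕ∞) l) (hh : ContDiff ℝ (⊤ : ℕ∞) h)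
    (η F G : ℝ → ℝ)
    (hη : ∀ u, η u = ∫ v in (0:ℝ)..u, 2 * h v)
    (hF : ∀ t, F t = ∫ u in (0:ℝ)..t, l u * sin (η u))
    (hG : ∀ t, G t = ∫ u in (0:ℝ)..t, l u * cos (η u))
    (c₁ c₂ : ℝ)
    (hpos : ∀ t, 0 < (F t - c₁) ^ 2 + (G t - c₂) ^ 2)
    (y x : ℝ → ℝ)
    (hy : ∀ t, y t = Real.sqrt ((F t - c₁) ^ 2 + (G t - c₂) ^ 2))
    (hx : ∀ t, x t = ∫ u in (0:ℝ)..t,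
      (deriv F u * (G u - c₂) - deriv G u * (F u - c₁)) / y u)
    (γ : ℝ → ℝ × ℝ) (hγ : ∀ t, γ t = (x t, y t))
    (U : ℝ → ℝ × ℝ) (hU : ∀ t, U t = (-(F t - c₁), G t - c₂))
    (p : ℝ) (hlp : l p = 0)
    (hl' : deriv l p ≠ 0) (hη' : deriv η p = 0)
    (k : ℝ) (hk : k = iteratedDeriv 2 l p / deriv l p) :
    iteratedDeriv 2 γ p ≠ 0 ∧
    iteratedDeriv 3 γ p = k • iteratedDeriv 2 γ p ∧
    det2 (iteratedDeriv 2 γ p)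
        ((3 : ℝ) • iteratedDeriv 5 γ p - (10 * k) • iteratedDeriv 4 γ p)
      = 12 * deriv l p *
        (iteratedDeriv 2 l p * iteratedDeriv 2 η p - deriv l p * iteratedDeriv 3 η p) ∧
    (det2 (iteratedDeriv 2 γ p)
        ((3 : ℝ) • iteratedDeriv 5 γ p - (10 * k) • iteratedDeriv 4 γ p) ≠ 0 ↔
      iteratedDeriv 2 l p * iteratedDeriv 2 η p - deriv l p * iteratedDeriv 3 η p ≠ 0) := by
  have η0 : ∀ t, HasDerivAt η (2 * h t) t :=
    hasDerivAt_of_eq_integral (continuous_const.mul hh.continuous) hη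
  have hηs : ContDiff ℝ (⊤ : ℕ∞) η := contDiff_of_hasDerivAt (contDiff_const.mul hh) η0
  have hF's : ContDiff ℝ (⊤ : ℕ∞) fun u => l u * sin (η u) := hl.mul hηs.sin
  have hG's : ContDiff ℝ (⊤ : ℕ∞) fun u => l u * cos (η u) := hl.mul hηs.cos
  have F0 := hasDerivAt_of_eq_integral hF's.continuous hF
  have G0 := hasDerivAt_of_eq_integral hG's.continuous hG
  have hFs := contDiff_of_hasDerivAt hF's F0
  have hGs := contDiff_of_hasDerivAt hG's G0
  have hypos (t) : 0 < y t := hy t ▸ Real.sqrt_pos.2 (hpos t)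
  have hyne (t) : y t ≠ 0 := (hypos t).ne'
  have hysq (t) : y t ^ 2 = (F t - c₁) ^ 2 + (G t - c₂) ^ 2 := by
    rw [hy, Real.sq_sqrt (hpos t).le]
  have hys : ContDiff ℝ (⊤ : ℕ∞) y := by
    rw [show y = fun t => Real.sqrt ((F t - c₁) ^ 2 + (G t - c₂) ^ 2) from funext hy]
    exact ContDiff.sqrt (((hFs.sub contDiff_const).pow 2).add ((hGs.sub contDiff_const).pow 2))
      fun t => (hpos t).ne'
  let S (t : ℝ) := (sin (η t) * (G t - c₂) - cos (η t) * (F t - c₁)) / y t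
  let C (t : ℝ) := (sin (η t) * (F t - c₁) + cos (η t) * (G t - c₂)) / y t
  have hSs : ContDiff ℝ (⊤ : ℕ∞) S :=
    ((hηs.sin.mul (hGs.sub contDiff_const)).sub (hηs.cos.mul (hFs.sub contDiff_const))).div hys hyne
  have hSC (t) : S t ^ 2 + C t ^ 2 = 1 := by
    simp only [S, C]
    rw [div_pow, div_pow, ← add_div, div_eq_one_iff_eq (pow_ne_zero 2 (hyne t)), hysq]
    linear_combination ((F t - c₁) ^ 2 + (G t - c₂) ^ 2) * sin_sq_add_cos_sq (η t)
  have y0 (t) : HasDerivAt y (l t * C t) t := by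
    have h1 := (((F0 t).sub_const c₁).pow 2).add (((G0 t).sub_const c₂).pow 2)
    have h2 := (h1.sqrt (hpos t).ne')
    rw [show y = fun t => Real.sqrt ((F t - c₁) ^ 2 + (G t - c₂) ^ 2) from funext hy]
    refine h2.congr_deriv ?_
    simp only [C, Pi.add_apply, Pi.pow_apply, ← hy]
    have := hyne t
    field_simp
    ring
  have x0 (t) : HasDerivAt x (l t * S t) t := by
    refine hasDerivAt_of_eq_integral (f' := fun t => l t * S t) (hl.mul hSs).continuous
      (fun t => ?_) t
    rw [hx]
    congr 1
    funext u
    rw [(F0 u).deriv, (G0 u).deriv]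
    simp only [S]
    ring
  have γ0 (t) : HasDerivAt γ (frameVec (S t) (C t) (l t) 0) t := by
    rw [show γ = fun t => (x t, y t) from funext hγ]
    exact ((x0 t).prodMk (y0 t)).congr_deriv (by simp [frameVec])
  let r (t : ℝ) := S t / y t
  let w (t : ℝ) := deriv η t - l t * r t
  have hrs : ContDiff ℝ (⊤ : ℕ∞) r := hSs.div hys hyne
  have hη's : ContDiff ℝ (⊤ : ℕ∞) (deriv η) := (contDiff_infty_iff_deriv.1 hηs).2
  have hws : ContDiff ℝ (⊤ : ℕ∞) w := hη's.sub (hl.mul hrs)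
  have S0 (t) : HasDerivAt S (w t * C t) t := by
    have h1 := (((η0 t).sin.mul ((G0 t).sub_const c₂)).sub
      ((η0 t).cos.mul ((F0 t).sub_const c₁))).div (y0 t) (hyne t)
    refine h1.congr_deriv ?_
    simp only [w, r, S, C, (η0 t).deriv, Pi.sub_apply, Pi.mul_apply]
    have := hyne t
    field_simp
    ring
  have C0 (t) : HasDerivAt C (-(w t * S t)) t := by
    have h1 := (((η0 t).sin.mul ((F0 t).sub_const c₁)).add
      ((η0 t).cos.mul ((G0 t).sub_const c₂))).div (y0 t) (hyne t)
    refine h1.congr_deriv ?_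
    have h2 := hSC t
    simp only [S, C] at h2
    have := hyne t
    simp only [w, r, S, C, (η0 t).deriv, Pi.add_apply, Pi.mul_apply]
    field_simp at h2 ⊢
    linear_combination (-l t) * h2 + l t * y t ^ 2 * sin_sq_add_cos_sq (η t)
  have hwp : w p = 0 := by simp [w, hlp, hη']
  obtain ⟨e2, e3, ⟨P, e4⟩, ⟨R, e5⟩⟩ :=
    iteratedDeriv_of_deriv_eq_frameVec hl hws S0 C0 γ0 hlp hwp
  have r0 : deriv r p = 0 := by
    refine (((S0 p).div (y0 p) (hyne p)).deriv).trans ?_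
    simp [hwp, hlp]
  have l0 (t) : HasDerivAt l (deriv l t) t := by
    simpa using hl.hasDerivAt_iteratedDeriv 0 t
  have l1 : HasDerivAt (deriv l) (iteratedDeriv 2 l p) p := by
    simpa using hl.hasDerivAt_iteratedDeriv 1 p
  have r0' (t) : HasDerivAt r (deriv r t) t := by
    simpa using hrs.hasDerivAt_iteratedDeriv 0 t
  have r1 : HasDerivAt (deriv r) (iteratedDeriv 2 r p) p := by
    simpa using hrs.hasDerivAt_iteratedDeriv 1 p
  have η1 (t) : HasDerivAt (deriv η) (iteratedDeriv 2 η t) t := by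
    simpa using hηs.hasDerivAt_iteratedDeriv 1 t
  have w1 : deriv w = fun t => iteratedDeriv 2 η t - (deriv l t * r t + l t * deriv r t) :=
    funext fun t => ((η1 t).sub ((l0 t).mul (r0' t))).deriv
  have w1p : deriv w p = iteratedDeriv 2 η p - deriv l p * r p := by
    simp [w1, hlp]
  have w2p : iteratedDeriv 2 w p = iteratedDeriv 3 η p - iteratedDeriv 2 l p * r p := by
    rw [iteratedDeriv_succ, iteratedDeriv_one, w1]
    refine (((hηs.hasDerivAt_iteratedDeriv 2 p).sub ((l1.mul (r0' p)).add
      ((l0 p).mul r1))).deriv).trans ?_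
    simp [hlp, r0]
  have hkl : k * deriv l p = iteratedDeriv 2 l p := by
    rw [hk]
    field_simp
  have hdet : det2 (iteratedDeriv 2 γ p)
        ((3 : ℝ) • iteratedDeriv 5 γ p - (10 * k) • iteratedDeriv 4 γ p)
      = 12 * deriv l p *
        (iteratedDeriv 2 l p * iteratedDeriv 2 η p - deriv l p * iteratedDeriv 3 η p) := by
    rw [e2, e4, e5, w1p, w2p, ← hkl]
    simp only [frameVec, det2, Prod.fst_sub, Prod.snd_sub, Prod.smul_fst, Prod.smul_snd,
      smul_eq_mul]
    linear_combination (12 * deriv l p *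
      (k * deriv l p * iteratedDeriv 2 η p - deriv l p * iteratedDeriv 3 η p)) * hSC p
  refine ⟨fun h0 => ?_, ?_, hdet, ?_⟩
  · rw [e2] at h0
    simp only [frameVec, Prod.mk_eq_zero, zero_mul, add_zero, sub_zero, mul_eq_zero, hl',
      false_or] at h0
    simpa [h0.1, h0.2] using hSC p
  · rw [e2, e3, ← hkl]
    simp [frameVec, mul_assoc]
  · rw [hdet]
    simp [hl']
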